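/- Robust global reliability (abstract form of Theorem 5.1): in the abstract robust setting, let A_st, A_ad ≥ 0 satisfy ‖ŷ − y_T‖_R ≤ A_st and ‖p̂ − p_T‖_R ≤ A_ad. Then ‖ȳ − y_T‖_R² + ‖p̄ − p_T‖_R² + ‖ū − u_T‖_H² ≤ (1 + 18/κ + 324/κ³)(2 + 648/(ϑ²κ⁴)) η_ct² + (72/(ϑ²κ³) + (1 + 18/κ²)(2 + 1296/(ϑ²κ⁴))) A_st² + (4/(ϑ²κ) + 72/(ϑ²κ²) + 2 + 1296/(ϑ²κ⁴)) A_ad². In particular, the total error is bounded by a constant depending only on κ and ϑ times η_ct² + A_st² + A_ad². -/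

import Mathlib

open MeasureTheory
open scoped InnerProductSpace

/-- The variational inequality characterizing the pointwise projection onto `[a, b]` in `L²`. -/
theorem inner_clamp_sub_nonneg {Ω : Type*} [MeasurableSpace Ω] {μ : Measure Ω}
    {a b : ℝ} (hab : a ≤ b) {w p u : Lp ℝ 2 μ}
    (hp : (⇑p) =ᵐ[μ] fun x => min b (max a (w x)))
    (hu : ∀ᵐ x ∂μ, a ≤ u x ∧ u x ≤ b) :
    0 ≤ ⟪p - w, u - p⟫_ℝ := by
  rw [L2.inner_def]
  apply integral_nonneg_of_ae
  filter_upwards [hp, hu, Lp.coeFn_sub p w, Lp.coeFn_sub u p] with x hpx ⟨hax, hxb⟩ h₁ h₂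
  rw [h₁, h₂]
  simp only [Pi.zero_apply, Pi.sub_apply, hpx, RCLike.inner_apply, conj_trivial]
  rcases le_total (w x) a with h | h
  · rw [max_eq_left h, min_eq_right hab]
    exact mul_nonneg (by linarith) (by linarith)
  · rw [max_eq_right h]
    rcases le_total (w x) b with h' | h'
    · rw [min_eq_right h']
      simp
    · rw [min_eq_left h']
      exact mul_nonneg_of_nonpos_of_nonpos (by linarith) (by linarith)

/-- An inf-sup stable form with an `L²`-type right-hand side gives an a priori bound. -/
theorem le_three_mul_norm_of_infSup {H V : Type*} [NormedAddCommGroup H] [InnerProductSpace ℝ H]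
    [AddCommGroup V] [Module ℝ V] {N M : V → ℝ} {ι : V →ₗ[ℝ] H} {s : ℝ}
    (hι : ∀ v, ‖ι v‖ ≤ s * N v) {B : V →ₗ[ℝ] V →ₗ[ℝ] ℝ}
    (hB : ∀ w : V, ∀ c : ℝ, (∀ v : V, B w v ≤ c * N v) → M w ≤ 3 * c)
    {w : V} {g : H} (hw : ∀ v, B w v = ⟪g, ι v⟫_ℝ) :
    M w ≤ 3 * (s * ‖g‖) := by
  refine hB w _ fun v => ?_
  rw [hw]
  calc ⟪g, ι v⟫_ℝ ≤ ‖g‖ * ‖ι v‖ := real_inner_le_norm _ _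
    _ ≤ ‖g‖ * (s * N v) := by gcongr; exact hι v
    _ = s * ‖g‖ * N v := by ring

theorem sq_le_two_mul_add_two_mul {x y z : ℝ} (hx : 0 ≤ x) (h : x ≤ y + z) :
    x ^ 2 ≤ 2 * y ^ 2 + 2 * z ^ 2 := by
  nlinarith [sq_nonneg (y - z)]

/-- Robust global reliability (abstract form of Theorem 5.1): with
`A_st, A_ad ≥ 0` such that `‖ŷ − y_T‖_R ≤ A_st` and `‖p̂ − p_T‖_R ≤ A_ad`,
`‖ȳ − y_T‖_R² + ‖p̄ − p_T‖_R² + ‖ū − u_T‖²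
  ≤ (1 + 18/κ + 324/κ³)(2 + 648/(ϑ²κ⁴)) η_ct²
    + (72/(ϑ²κ³) + (1 + 18/κ²)(2 + 1296/(ϑ²κ⁴))) A_st²
    + (4/(ϑ²κ) + 72/(ϑ²κ²) + 2 + 1296/(ϑ²κ⁴)) A_ad²`. -/
theorem robust_global_reliability
    {Ω : Type*} [MeasurableSpace Ω] (μ : Measure Ω) [IsFiniteMeasure μ]
    (a b : ℝ) (hab : a < b)
    (Pi : Lp ℝ 2 μ → Lp ℝ 2 μ)
    (hPi : ∀ w : Lp ℝ 2 μ, (⇑(Pi w)) =ᵐ[μ] fun x => min b (max a (w x)))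
    (κ ϑ : ℝ) (hκ : 0 < κ) (hϑ : 0 < ϑ)
    {V : Type*} [AddCommGroup V] [Module ℝ V]
    (NOm NR : V → ℝ)
    (hNOm_add : ∀ v w : V, NOm (v + w) ≤ NOm v + NOm w)
    (hNOm_smul : ∀ (c : ℝ) (v : V), NOm (c • v) = |c| * NOm v)
    (hNOm_eq_zero : ∀ v : V, NOm v = 0 ↔ v = 0)
    (hNR_add : ∀ v w : V, NR (v + w) ≤ NR v + NR w)
    (hNR_smul : ∀ (c : ℝ) (v : V), NR (c • v) = |c| * NR v)
    (hNR_eq_zero : ∀ v : V, NR v = 0 ↔ v = 0)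
    (hOmR : ∀ v : V, NOm v ≤ NR v)
    (ι : V →ₗ[ℝ] Lp ℝ 2 μ)
    (hι : ∀ v : V, ‖ι v‖ ≤ (Real.sqrt κ)⁻¹ * NOm v)
    (B Bstar : V →ₗ[ℝ] V →ₗ[ℝ] ℝ)
    (hBstar : ∀ w v : V, Bstar w v = B v w)
    (hinfsupB : ∀ w : V, ∀ c : ℝ, (∀ v : V, B w v ≤ c * NOm v) → NR w ≤ 3 * c)
    (hinfsupBstar : ∀ w : V, ∀ c : ℝ, (∀ v : V, Bstar w v ≤ c * NOm v) → NR w ≤ 3 * c)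
    (f yΩ : Lp ℝ 2 μ)
    (ybar pbar : V) (ubar : Lp ℝ 2 μ)
    (hubar_mem : ∀ᵐ x ∂μ, a ≤ ubar x ∧ ubar x ≤ b)
    (hstate : ∀ v : V, B ybar v = ⟪f + ubar, ι v⟫_ℝ)
    (hadjoint : ∀ w : V, Bstar pbar w = ⟪ι ybar - yΩ, ι w⟫_ℝ)
    (hVI : ∀ u : Lp ℝ 2 μ, (∀ᵐ x ∂μ, a ≤ u x ∧ u x ≤ b) →
        0 ≤ ⟪ι pbar + ϑ • ubar, u - ubar⟫_ℝ)
    (yT pT : V) (uT : Lp ℝ 2 μ)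
    (huT_mem : ∀ᵐ x ∂μ, a ≤ uT x ∧ uT x ≤ b)
    (utilde : Lp ℝ 2 μ) (hutilde : utilde = Pi (-ϑ⁻¹ • ι pT))
    (ηct : ℝ) (hηct : ηct = ‖uT - utilde‖)
    (yhat phat ytilde ptilde : V)
    (hyhat : ∀ v : V, B yhat v = ⟪f + uT, ι v⟫_ℝ)
    (hphat : ∀ w : V, Bstar phat w = ⟪ι yT - yΩ, ι w⟫_ℝ)
    (hytilde : ∀ v : V, B ytilde v = ⟪f + utilde, ι v⟫_ℝ)
    (hptilde : ∀ w : V, Bstar ptilde w = ⟪ι ytilde - yΩ, ι w⟫_ℝ)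
    (Ast Aad : ℝ) (hAst0 : 0 ≤ Ast) (hAad0 : 0 ≤ Aad)
    (hAst : NR (yhat - yT) ≤ Ast) (hAad : NR (phat - pT) ≤ Aad) :
    NR (ybar - yT) ^ 2 + NR (pbar - pT) ^ 2 + ‖ubar - uT‖ ^ 2
      ≤ (1 + 18 / κ + 324 / κ ^ 3) * (2 + 648 / (ϑ ^ 2 * κ ^ 4)) * ηct ^ 2
        + (72 / (ϑ ^ 2 * κ ^ 3) + (1 + 18 / κ ^ 2) * (2 + 1296 / (ϑ ^ 2 * κ ^ 4))) * Ast ^ 2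
        + (4 / (ϑ ^ 2 * κ) + 72 / (ϑ ^ 2 * κ ^ 2) + 2 + 1296 / (ϑ ^ 2 * κ ^ 4)) * Aad ^ 2 := by
  set s : ℝ := (Real.sqrt κ)⁻¹ with hs
  have hs0 : 0 < s := inv_pos.mpr (Real.sqrt_pos.mpr hκ)
  have hs2 : s ^ 2 = 1 / κ := by rw [hs, inv_pow, Real.sq_sqrt hκ.le, one_div]
  have hNR0 (v : V) : 0 ≤ NR v :=
    (nonneg_of_mul_nonneg_right ((norm_nonneg _).trans (hι v)) hs0).trans (hOmR v)
  have hιR (v : V) : ‖ι v‖ ≤ s * NR v := (hι v).trans (by gcongr; exact hOmR v)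
  have hB_sub {y₁ y₂ : V} {u₁ u₂ : Lp ℝ 2 μ} (h₁ : ∀ v, B y₁ v = ⟪f + u₁, ι v⟫_ℝ)
      (h₂ : ∀ v, B y₂ v = ⟪f + u₂, ι v⟫_ℝ) (v : V) : B (y₁ - y₂) v = ⟪u₁ - u₂, ι v⟫_ℝ := by
    rw [map_sub, LinearMap.sub_apply, h₁, h₂, ← inner_sub_left, add_sub_add_left_eq_sub]
  have hBstar_sub {p₁ p₂ : V} {y₁ y₂ : V} (h₁ : ∀ w, Bstar p₁ w = ⟪ι y₁ - yΩ, ι w⟫_ℝ)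
      (h₂ : ∀ w, Bstar p₂ w = ⟪ι y₂ - yΩ, ι w⟫_ℝ) (w : V) :
      Bstar (p₁ - p₂) w = ⟪ι (y₁ - y₂), ι w⟫_ℝ := by
    rw [map_sub, LinearMap.sub_apply, h₁, h₂, ← inner_sub_left, sub_sub_sub_cancel_right, map_sub]
  have hNR_tri (x y z : V) : NR (x - z) ≤ NR (x - y) + NR (y - z) := by
    simpa using hNR_add (x - y) (y - z)
  have hι_tri (x y z : V) : ‖ι (x - z)‖ ≤ ‖ι (x - y)‖ + ‖ι (y - z)‖ := by
    simpa using norm_add_le (ι (x - y)) (ι (y - z))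
  have hutilde_mem : ∀ᵐ x ∂μ, a ≤ utilde x ∧ utilde x ≤ b := by
    filter_upwards [hPi (-ϑ⁻¹ • ι pT)] with x hx
    rw [hutilde, hx]
    exact ⟨le_min hab.le (le_max_left _ _), min_le_left _ _⟩
  have hproj : 0 ≤ ⟪ι pT + ϑ • utilde, ubar - utilde⟫_ℝ := by
    have h := inner_clamp_sub_nonneg hab.le (hPi (-ϑ⁻¹ • ι pT)) hubar_mem
    rw [← hutilde] at h
    have hscale : ι pT + ϑ • utilde = ϑ • (utilde - (-ϑ⁻¹ • ι pT)) := by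
      rw [neg_smul, sub_neg_eq_add, smul_add, smul_smul, mul_inv_cancel₀ hϑ.ne', one_smul,
        add_comm]
    rw [hscale, real_inner_smul_left]
    exact mul_nonneg hϑ.le h
  have hsign : ⟪ι (pbar - ptilde), utilde - ubar⟫_ℝ ≤ 0 := by
    have h₁ := hB_sub hytilde hstate (pbar - ptilde)
    have h₂ := hBstar_sub hadjoint hptilde (ytilde - ybar)
    rw [hBstar, h₁, ← neg_sub ytilde ybar, map_neg, inner_neg_left,
      real_inner_self_eq_norm_sq] at h₂
    rw [real_inner_comm, h₂]
    exact neg_nonpos.mpr (sq_nonneg _)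
  have hcontrol : ϑ * ‖ubar - utilde‖ ≤ ‖ι (ptilde - pT)‖ := by
    have hsum : ϑ * ‖ubar - utilde‖ ^ 2 ≤
        ⟪ι (pbar - ptilde), utilde - ubar⟫_ℝ + ⟪ι (ptilde - pT), utilde - ubar⟫_ℝ := by
      have hv := hVI utilde hutilde_mem
      rw [← real_inner_self_eq_norm_sq]
      simp only [map_sub, inner_add_left, inner_sub_left, inner_sub_right,
        real_inner_smul_left] at hv hproj ⊢
      linarith
    have hcs := real_inner_le_norm (ι (ptilde - pT)) (utilde - ubar)
    rw [norm_sub_rev utilde ubar] at hcs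
    rcases (norm_nonneg (ubar - utilde)).eq_or_lt with h | h
    · rw [← h, mul_zero]
      exact norm_nonneg _
    · refine le_of_mul_le_mul_right ?_ h
      nlinarith
  have hytilde_yhat : ‖ι (ytilde - yhat)‖ ≤ 3 * s ^ 2 * ηct := by
    have h := le_three_mul_norm_of_infSup hι hinfsupB (hB_sub hytilde hyhat)
    rw [norm_sub_rev, ← hηct] at h
    calc _ ≤ s * NR (ytilde - yhat) := hιR _
      _ ≤ s * (3 * (s * ηct)) := by gcongr
      _ = _ := by ring
  have hyhat_yT : ‖ι (yhat - yT)‖ ≤ s * Ast := (hιR _).trans (by gcongr)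
  have hphat_pT : ‖ι (phat - pT)‖ ≤ s * Aad := (hιR _).trans (by gcongr)
  have hptilde_phat : ‖ι (ptilde - phat)‖ ≤ 3 * s ^ 2 * ‖ι (ytilde - yT)‖ := by
    have h := le_three_mul_norm_of_infSup hι hinfsupBstar (hBstar_sub hptilde hphat)
    calc _ ≤ s * NR (ptilde - phat) := hιR _
      _ ≤ s * (3 * (s * ‖ι (ytilde - yT)‖)) := by gcongr
      _ = _ := by ring
  have hy_sq : ‖ι (ytilde - yT)‖ ^ 2 ≤ 2 * (3 * s ^ 2 * ηct) ^ 2 + 2 * (s * Ast) ^ 2 :=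
    sq_le_two_mul_add_two_mul (norm_nonneg _)
      ((hι_tri _ yhat _).trans (add_le_add hytilde_yhat hyhat_yT))
  have hp_sq : ‖ι (ptilde - pT)‖ ^ 2 ≤
      2 * (3 * s ^ 2 * ‖ι (ytilde - yT)‖) ^ 2 + 2 * (s * Aad) ^ 2 :=
    sq_le_two_mul_add_two_mul (norm_nonneg _)
      ((hι_tri _ phat _).trans (add_le_add hptilde_phat hphat_pT))
  have hcontrol_sq : ‖ubar - utilde‖ ^ 2 ≤
      (ϑ⁻¹) ^ 2 * (324 * (s ^ 2) ^ 4 * ηct ^ 2 + 36 * (s ^ 2) ^ 3 * Ast ^ 2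
        + 2 * s ^ 2 * Aad ^ 2) := by
    have h : (ϑ * ‖ubar - utilde‖) ^ 2 ≤ ‖ι (ptilde - pT)‖ ^ 2 := by gcongr
    rw [inv_pow, ← div_eq_inv_mul, le_div_iff₀ (by positivity)]
    nlinarith [mul_le_mul_of_nonneg_left hy_sq (by positivity : (0 : ℝ) ≤ 18 * (s ^ 2) ^ 2)]
  have hu_sq : ‖ubar - uT‖ ^ 2 ≤ 2 * ‖ubar - utilde‖ ^ 2 + 2 * ηct ^ 2 := by
    refine sq_le_two_mul_add_two_mul (norm_nonneg _) ?_
    rw [hηct, norm_sub_rev uT]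
    exact norm_sub_le_norm_sub_add_norm_sub _ _ _
  have hstate_sq : NR (ybar - yT) ^ 2 ≤ 18 * s ^ 2 * ‖ubar - uT‖ ^ 2 + 2 * Ast ^ 2 := by
    have h := sq_le_two_mul_add_two_mul (hNR0 _) ((hNR_tri ybar yhat yT).trans
      (add_le_add (le_three_mul_norm_of_infSup hι hinfsupB (hB_sub hstate hyhat)) hAst))
    linarith
  have hadjoint_sq : NR (pbar - pT) ^ 2 ≤
      18 * (s ^ 2) ^ 2 * NR (ybar - yT) ^ 2 + 2 * Aad ^ 2 := by
    have hp : NR (pbar - phat) ≤ 3 * (s * (s * NR (ybar - yT))) :=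
      (le_three_mul_norm_of_infSup hι hinfsupBstar (hBstar_sub hadjoint hphat)).trans
        (by gcongr; exact hιR _)
    have h := sq_le_two_mul_add_two_mul (hNR0 _)
      ((hNR_tri pbar phat pT).trans (add_le_add hp hAad))
    linarith
  rw [hs2] at hcontrol_sq hstate_sq hadjoint_sq
  set E : ℝ := (ϑ⁻¹) ^ 2 * (324 * (1 / κ) ^ 4 * ηct ^ 2 + 36 * (1 / κ) ^ 3 * Ast ^ 2
    + 2 * (1 / κ) * Aad ^ 2) with hE
  calc _ ≤ (1 + 18 * (1 / κ) + 324 * (1 / κ) ^ 3) * ‖ubar - uT‖ ^ 2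
        + (2 + 36 * (1 / κ) ^ 2) * Ast ^ 2 + 2 * Aad ^ 2 := by
        have h := mul_le_mul_of_nonneg_left hstate_sq
          (by positivity : (0 : ℝ) ≤ 1 + 18 * (1 / κ) ^ 2)
        linarith
    _ ≤ (1 + 18 * (1 / κ) + 324 * (1 / κ) ^ 3) * (2 * E + 2 * ηct ^ 2)
        + (2 + 36 * (1 / κ) ^ 2) * Ast ^ 2 + 2 * Aad ^ 2 := by
        gcongr
        linarith
    _ = _ := by
        rw [hE]
        field_simp
        ring
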